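/- Let m ≥ 1, let c₁,…,c_m and b₁,…,b_m be real numbers such that Σ_{i=1}^m b_i·p(c_i) = ∫₀¹ p(x) dx for every real polynomial p of degree at most 2m−1, and let A = (a_{ij}) be an m×m real matrix satisfying the simplifying condition C(m): Σ_{j=1}^m a_{ij}·c_j^{q−1} = c_i^q/q for all i = 1,…,m and q = 1,…,m. Define W by w_{ij} = P̃_{j−1}(c_i), B = diag(b₁,…,b_m), and X = Wᵀ·B·A·W. Then, with ζ_q = 1/(2·√(4q²−1)), the matrix X is tridiagonal with x₁₁ = 1/2, x_{q+1,q} = ζ_q and x_{q,q+1} = −ζ_q for q = 1,…,m−1, and all other entries (including all remaining diagonal entries) equal to 0. -/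

import Mathlib

open Finset Matrix

/-- The normalized shifted Legendre polynomial of degree `n`:
`P̃_n(x) = √(2n+1) · Σ_{k=0}^{n} (−1)^{n+k} · C(n,k) · C(n+k,k) · x^k`. -/
noncomputable def shiftedLegendre (n : ℕ) (x : ℝ) : ℝ :=
  Real.sqrt (2 * n + 1) *
    ∑ k ∈ Finset.range (n + 1),
      (-1 : ℝ) ^ (n + k) * (n.choose k : ℝ) * ((n + k).choose k : ℝ) * x ^ k

/-- `ζ_q = 1/(2·√(4q²−1))`. -/
noncomputable def zetaIRK (q : ℕ) : ℝ := 1 / (2 * Real.sqrt (4 * (q : ℝ) ^ 2 - 1))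

open Polynomial in
/-- The shifted Legendre polynomial of degree `n`, normalized to take the value `1` at `1`. -/
noncomputable def legendrePoly (n : ℕ) : ℝ[X] :=
  ∑ k ∈ Finset.range (n + 1),
    C ((-1 : ℝ) ^ (n + k) * (n.choose k : ℝ) * ((n + k).choose k : ℝ)) * X ^ k

open Polynomial in
/-- The antiderivative of `legendrePoly n` that vanishes at `0`. -/
noncomputable def legendrePrimitive (n : ℕ) : ℝ[X] :=
  ∑ k ∈ Finset.range (n + 1),
    C ((legendrePoly n).coeff k / (k + 1)) * X ^ (k + 1)

namespace legendrePoly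

open Polynomial Nat

theorem coeff_eq (n k : ℕ) :
    (legendrePoly n).coeff k =
      (-1 : ℝ) ^ (n + k) * (n.choose k : ℝ) * ((n + k).choose k : ℝ) := by
  simp only [legendrePoly, finsetSum_coeff, coeff_C_mul, coeff_X_pow, mul_ite, mul_one, mul_zero,
    Finset.sum_ite_eq, Finset.mem_range]
  split_ifs with h
  · rfl
  · simp [Nat.choose_eq_zero_of_lt (show n < k by omega)]

theorem coeff_of_lt {n k : ℕ} (h : n < k) : (legendrePoly n).coeff k = 0 := by
  simp [coeff_eq, Nat.choose_eq_zero_of_lt h]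

theorem coeff_add (k d : ℕ) :
    (legendrePoly (k + d)).coeff k =
      (-1 : ℝ) ^ d * ((2 * k + d)! : ℝ) / ((k ! : ℝ) ^ 2 * (d ! : ℝ)) := by
  have h₁ : ((k + d).choose k : ℝ) = ((k + d)! : ℝ) / (k ! * d !) := Nat.cast_add_choose ℝ
  have h₂ : ((k + d + k).choose k : ℝ) = ((2 * k + d)! : ℝ) / (k ! * (k + d)!) := by
    rw [show k + d + k = k + (k + d) by ring, Nat.cast_add_choose ℝ,
      show k + (k + d) = 2 * k + d by ring]
  have h₃ : (-1 : ℝ) ^ (k + d + k) = (-1) ^ d := by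
    rw [show k + d + k = 2 * k + d by ring, pow_add, pow_mul]
    simp
  rw [coeff_eq, h₁, h₂, h₃]
  have := Nat.factorial_ne_zero k
  have := Nat.factorial_ne_zero d
  have := Nat.factorial_ne_zero (k + d)
  field_simp

theorem recurrence_coeff_succ (n k : ℕ) :
    ((n : ℝ) + 2) * (legendrePoly (n + 2)).coeff (k + 1) =
      (2 * n + 3) * (2 * (legendrePoly (n + 1)).coeff k - (legendrePoly (n + 1)).coeff (k + 1)) -
        (n + 1) * (legendrePoly n).coeff (k + 1) := by
  have hk := Nat.factorial_ne_zero k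
  rcases lt_trichotomy n k with h | rfl | h
  · obtain rfl | h := (Nat.succ_le_of_lt h).eq_or_lt
    · rw [coeff_of_lt (show n + 1 < n.succ + 1 by omega),
        coeff_of_lt (show n < n.succ + 1 by omega)]
      have h₁ := coeff_add (n + 2) 0
      have h₂ := coeff_add (n + 1) 0
      simp only [add_zero] at h₁ h₂
      simp only [Nat.succ_eq_add_one]
      rw [h₁, h₂, show 2 * (n + 2) = 2 * n + 1 + 1 + 1 + 1 by ring,
        show 2 * (n + 1) = 2 * n + 1 + 1 by ring]
      have := Nat.factorial_ne_zero n
      simp only [Nat.factorial_succ, Nat.factorial_zero]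
      push_cast
      field_simp
      ring
    · rw [coeff_of_lt (show n + 2 < k + 1 by omega), coeff_of_lt (show n + 1 < k by omega),
        coeff_of_lt (show n + 1 < k + 1 by omega), coeff_of_lt (show n < k + 1 by omega)]
      ring
  · rw [coeff_of_lt (show n < n + 1 by omega), coeff_add n 1]
    have h₁ := coeff_add (n + 1) 0
    have h₂ := coeff_add (n + 1) 1
    rw [add_zero] at h₁
    rw [show n + 2 = n + 1 + 1 by ring, h₁, h₂, show 2 * (n + 1) + 1 = 2 * n + 1 + 1 + 1 by ring,
      show 2 * (n + 1) + 0 = 2 * n + 1 + 1 by ring]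
    simp only [Nat.factorial_succ, Nat.factorial_zero]
    push_cast
    field_simp
    ring
  · obtain ⟨d, rfl⟩ := Nat.exists_eq_add_of_le (Nat.succ_le_of_lt h)
    have h₀ := coeff_add (k + 1) d
    have h₁ := coeff_add (k + 1) (d + 1)
    have h₂ := coeff_add (k + 1) (d + 2)
    have h₃ := coeff_add k (d + 2)
    rw [show k.succ + d + 2 = k + 1 + (d + 2) by omega, h₂,
      show k.succ + d + 1 = k + 1 + (d + 1) by omega, h₁,
      show k + 1 + (d + 1) = k + (d + 2) by omega, h₃, Nat.succ_eq_add_one, h₀,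
      show 2 * (k + 1) + (d + 2) = 2 * k + d + 1 + 1 + 1 + 1 by ring,
      show 2 * (k + 1) + (d + 1) = 2 * k + d + 1 + 1 + 1 by ring,
      show 2 * (k + 1) + d = 2 * k + d + 1 + 1 by ring,
      show 2 * k + (d + 2) = 2 * k + d + 1 + 1 by ring]
    have := Nat.factorial_ne_zero d
    simp only [Nat.factorial_succ]
    push_cast
    field_simp
    ring

theorem recurrence (n : ℕ) :
    C ((n : ℝ) + 2) * legendrePoly (n + 2) =
      C (2 * n + 3 : ℝ) * (2 * (X * legendrePoly (n + 1)) - legendrePoly (n + 1)) -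
        C ((n : ℝ) + 1) * legendrePoly n := by
  have h2 : (2 : ℝ[X]) = C 2 := rfl
  ext k
  simp only [coeff_C_mul, coeff_sub, h2]
  cases k with
  | zero =>
    simp only [coeff_eq, coeff_X_mul_zero]
    simp
    ring
  | succ k => rw [coeff_X_mul, recurrence_coeff_succ]

theorem natDegree_le (n : ℕ) : (legendrePoly n).natDegree ≤ n :=
  natDegree_le_iff_coeff_eq_zero.2 fun _ h => coeff_of_lt h

theorem eval_eq_sum (n : ℕ) (x : ℝ) :
    (legendrePoly n).eval x = ∑ k ∈ Finset.range (n + 1), (legendrePoly n).coeff k * x ^ k :=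
  eval_eq_sum_range' (Nat.lt_succ_of_le (natDegree_le n)) x

theorem sqrt_mul_eval (n : ℕ) (x : ℝ) :
    _root_.shiftedLegendre n x = √(2 * n + 1) * (legendrePoly n).eval x := by
  simp only [_root_.shiftedLegendre, eval_eq_sum, coeff_eq]

theorem integral_pow_mul_recurrence (p n : ℕ) :
    ((n : ℝ) + 2) * ∫ x in (0 : ℝ)..1, x ^ p * (legendrePoly (n + 2)).eval x =
      (2 * n + 3) * (2 * (∫ x in (0 : ℝ)..1, x ^ (p + 1) * (legendrePoly (n + 1)).eval x) -
          ∫ x in (0 : ℝ)..1, x ^ p * (legendrePoly (n + 1)).eval x) -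
        (n + 1) * ∫ x in (0 : ℝ)..1, x ^ p * (legendrePoly n).eval x := by
  have hi (q k : ℕ) : IntervalIntegrable (fun x : ℝ => x ^ q * (legendrePoly k).eval x)
      MeasureTheory.volume 0 1 :=
    ((continuous_pow q).mul (legendrePoly k).continuous).intervalIntegrable _ _
  simp only [← intervalIntegral.integral_const_mul]
  rw [← intervalIntegral.integral_sub ((hi _ _).const_mul 2) (hi _ _),
    ← intervalIntegral.integral_const_mul,
    ← intervalIntegral.integral_sub ((((hi _ _).const_mul 2).sub (hi _ _)).const_mul _)
      ((hi _ _).const_mul _)]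
  congr 1
  ext x
  have h := congrArg (eval x) (recurrence n)
  simp only [eval_mul, eval_sub, eval_C, eval_X, eval_ofNat] at h
  linear_combination x ^ p * h

theorem cast_descFactorial_succ (p n : ℕ) :
    (p.descFactorial (n + 1) : ℝ) = ((p : ℝ) - n) * p.descFactorial n := by
  rw [Nat.descFactorial_succ]
  rcases le_or_gt n p with h | h
  · push_cast [Nat.cast_sub h]
    ring
  · simp [Nat.descFactorial_of_lt h]

theorem integral_pow_mul (n p : ℕ) :
    ∫ x in (0 : ℝ)..1, x ^ p * (legendrePoly n).eval x =
      (p ! : ℝ) * p.descFactorial n / ((p + n + 1)! : ℝ) := by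
  induction n using Nat.twoStepInduction generalizing p with
  | zero =>
    have := Nat.factorial_ne_zero p
    simp [legendrePoly, integral_pow, Nat.factorial_succ]
    field_simp
  | one =>
    have := Nat.factorial_ne_zero p
    have h : ∀ x : ℝ, x ^ p * (legendrePoly 1).eval x = 2 * x ^ (p + 1) - x ^ p := fun x => by
      simp [legendrePoly, Finset.sum_range_succ]
      ring
    simp only [h]
    rw [intervalIntegral.integral_sub
      (Continuous.intervalIntegrable (by fun_prop) _ _)
      (Continuous.intervalIntegrable (by fun_prop) _ _), intervalIntegral.integral_const_mul]
    simp [integral_pow, Nat.factorial_succ]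
    field_simp
    ring
  | more n ih₀ ih₁ =>
    have h := integral_pow_mul_recurrence p n
    rw [ih₀, ih₁, ih₁, Nat.succ_descFactorial_succ, cast_descFactorial_succ,
      show p + 1 + (n + 1) + 1 = p + n + 1 + 1 + 1 by ring,
      show p + (n + 1) + 1 = p + n + 1 + 1 by ring] at h
    rw [cast_descFactorial_succ, cast_descFactorial_succ,
      show p + (n + 2) + 1 = p + n + 1 + 1 + 1 by ring]
    have hn : (n : ℝ) + 2 ≠ 0 := by positivity
    apply mul_left_cancel₀ hn
    rw [h]
    have := Nat.factorial_ne_zero (p + n + 1)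
    rw [Nat.factorial_succ (p + n + 1 + 1), Nat.factorial_succ (p + n + 1), Nat.factorial_succ p]
    push_cast
    field_simp
    ring

theorem integral_eq (n : ℕ) :
    ∫ x in (0 : ℝ)..1, (legendrePoly n).eval x = if n = 0 then 1 else 0 := by
  have h := integral_pow_mul n 0
  simp only [pow_zero, one_mul] at h
  rw [h]
  split_ifs with hn
  · simp [hn]
  · simp [Nat.descFactorial_of_lt (Nat.pos_of_ne_zero hn)]

end legendrePoly

namespace legendrePrimitive

open Polynomial Nat

theorem eval_eq_sum (n : ℕ) (x : ℝ) :
    (legendrePrimitive n).eval x =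
      ∑ k ∈ Finset.range (n + 1), (legendrePoly n).coeff k / (k + 1) * x ^ (k + 1) := by
  simp [legendrePrimitive, eval_finsetSum]

theorem natDegree_le (n : ℕ) : (legendrePrimitive n).natDegree ≤ n + 1 := by
  refine natDegree_sum_le_of_forall_le _ _ fun k hk => ?_
  refine (natDegree_C_mul_X_pow_le _ _).trans ?_
  simpa [Nat.lt_succ_iff] using hk

theorem derivative_eq (n : ℕ) : derivative (legendrePrimitive n) = legendrePoly n := by
  simp only [legendrePrimitive, derivative_sum, derivative_C_mul_X_pow]
  conv_rhs => rw [legendrePoly]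
  refine Finset.sum_congr rfl fun k _ => ?_
  rw [← legendrePoly.coeff_eq, Nat.add_sub_cancel]
  congr 2
  push_cast
  field_simp

theorem hasDerivAt (n : ℕ) (x : ℝ) :
    HasDerivAt (fun x => (legendrePrimitive n).eval x) ((legendrePoly n).eval x) x := by
  simpa only [derivative_eq] using (legendrePrimitive n).hasDerivAt x

theorem eval_zero (n : ℕ) : (legendrePrimitive n).eval 0 = 0 := by
  simp [eval_eq_sum]

theorem eval_one (n : ℕ) : (legendrePrimitive n).eval 1 = if n = 0 then 1 else 0 := by
  rw [← legendrePoly.integral_eq, intervalIntegral.integral_eq_sub_of_hasDerivAt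
    (fun x _ => hasDerivAt n x) ((legendrePoly n).continuous.intervalIntegrable _ _), eval_zero,
    sub_zero]

theorem integral_mul_add_swap (i j : ℕ) :
    (∫ x in (0 : ℝ)..1, (legendrePoly i).eval x * (legendrePrimitive j).eval x) +
      ∫ x in (0 : ℝ)..1, (legendrePoly j).eval x * (legendrePrimitive i).eval x =
        if i = 0 ∧ j = 0 then 1 else 0 := by
  have h := intervalIntegral.integral_mul_deriv_eq_deriv_mul (a := 0) (b := 1)
    (fun x _ => hasDerivAt i x) (fun x _ => hasDerivAt j x)
    ((legendrePoly i).continuous.intervalIntegrable _ _)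
    ((legendrePoly j).continuous.intervalIntegrable _ _)
  simp only [mul_comm (eval _ (legendrePrimitive i)) (eval _ (legendrePoly j))] at h
  rw [h, eval_zero, eval_one, eval_one]
  by_cases hi : i = 0 <;> by_cases hj : j = 0 <;> simp [hi, hj]

theorem integral_mul_eq_sum (i j : ℕ) :
    ∫ x in (0 : ℝ)..1, (legendrePoly i).eval x * (legendrePrimitive j).eval x =
      ∑ k ∈ Finset.range (j + 1), (legendrePoly j).coeff k / (k + 1) *
        (((k + 1)! : ℝ) * (k + 1).descFactorial i / ((k + 1 + i + 1)! : ℝ)) := by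
  simp only [← legendrePoly.integral_pow_mul, ← intervalIntegral.integral_const_mul]
  rw [← intervalIntegral.integral_finsetSum fun k _ => Continuous.intervalIntegrable
    (by fun_prop) _ _]
  congr 1
  ext x
  rw [eval_eq_sum, Finset.mul_sum]
  exact Finset.sum_congr rfl fun k _ => by ring

theorem integral_mul_of_lt {i j : ℕ} (h : j + 1 < i) :
    ∫ x in (0 : ℝ)..1, (legendrePoly i).eval x * (legendrePrimitive j).eval x = 0 := by
  rw [integral_mul_eq_sum]
  refine Finset.sum_eq_zero fun k hk => ?_
  rw [Finset.mem_range] at hk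
  simp [Nat.descFactorial_of_lt (show k + 1 < i by omega)]

theorem integral_mul_succ (j : ℕ) :
    ∫ x in (0 : ℝ)..1, (legendrePoly (j + 1)).eval x * (legendrePrimitive j).eval x =
      1 / (2 * ((2 * j + 1) * (2 * j + 3))) := by
  rw [integral_mul_eq_sum, Finset.sum_range_succ, Finset.sum_eq_zero, zero_add]
  · have hc := legendrePoly.coeff_add j 0
    rw [add_zero] at hc
    rw [hc, Nat.descFactorial_self,
      show j + 1 + (j + 1) + 1 = 2 * j + 1 + 1 + 1 by ring, add_zero]
    have := Nat.factorial_ne_zero j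
    have := Nat.factorial_ne_zero (2 * j)
    simp only [Nat.factorial_succ, Nat.factorial_zero]
    push_cast
    field_simp
    ring
  · intro k hk
    rw [Finset.mem_range] at hk
    rw [Nat.descFactorial_of_lt (show k + 1 < j + 1 by omega)]
    simp

end legendrePrimitive

theorem sqrt_mul_sqrt_mul_eq_zetaIRK (j : ℕ) :
    √(2 * ((j + 1 : ℕ) : ℝ) + 1) * √(2 * j + 1) * (1 / (2 * ((2 * j + 1) * (2 * j + 3)))) =
      zetaIRK (j + 1) := by
  have h : (4 * ((j + 1 : ℕ) : ℝ) ^ 2 - 1) = (2 * ((j + 1 : ℕ) : ℝ) + 1) * (2 * j + 1) := by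
    push_cast
    ring
  have h₁ : (0 : ℝ) < 2 * ((j + 1 : ℕ) : ℝ) + 1 := by positivity
  have h₂ : (0 : ℝ) < 2 * (j : ℝ) + 1 := by positivity
  rw [zetaIRK, h, Real.sqrt_mul h₁.le,
    show (2 * (j : ℝ) + 1) * (2 * j + 3) =
      (√(2 * ((j + 1 : ℕ) : ℝ) + 1)) ^ 2 * (√(2 * (j : ℝ) + 1)) ^ 2 by
      rw [Real.sq_sqrt h₁.le, Real.sq_sqrt h₂.le]
      push_cast
      ring]
  have := Real.sqrt_pos.2 h₁
  have := Real.sqrt_pos.2 h₂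
  field_simp

/-- Condition `C(m)` makes `A` integrate Legendre polynomials of degree below `m`. -/
theorem sum_mul_shiftedLegendre_eq {m : ℕ} {c : Fin m → ℝ} {A : Matrix (Fin m) (Fin m) ℝ}
    (hC : ∀ i : Fin m, ∀ q : ℕ, 1 ≤ q → q ≤ m →
      ∑ j, A i j * c j ^ (q - 1) = c i ^ q / (q : ℝ)) (i : Fin m) {n : ℕ} (hn : n < m) :
    ∑ j, A i j * shiftedLegendre n (c j) = √(2 * n + 1) * (legendrePrimitive n).eval (c i) := by
  simp only [legendrePoly.sqrt_mul_eval, legendrePoly.eval_eq_sum, legendrePrimitive.eval_eq_sum,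
    Finset.mul_sum]
  rw [Finset.sum_comm]
  refine Finset.sum_congr rfl fun k hk => ?_
  rw [Finset.mem_range] at hk
  have h := hC i (k + 1) (by omega) (by omega)
  rw [Nat.add_sub_cancel] at h
  calc ∑ j, A i j * (√(2 * n + 1) * ((legendrePoly n).coeff k * c j ^ k))
      = √(2 * n + 1) * (legendrePoly n).coeff k * ∑ j, A i j * c j ^ k := by
        rw [Finset.mul_sum]
        exact Finset.sum_congr rfl fun j _ => by ring
    _ = _ := by
        rw [h]
        push_cast
        ring

/-- W-transformation (SPARK3-type reduction): under the quadrature hypothesis of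
order `2m−1` and the simplifying condition `C(m)`, the matrix `X = Wᵀ·B·A·W` is
tridiagonal with `x₁₁ = 1/2`, subdiagonal entries `ζ_q` and superdiagonal entries
`−ζ_q`, and all other entries `0` (indices written 0-based below). -/
theorem wTransformation_tridiagonal (m : ℕ) (hm : 1 ≤ m) (c b : Fin m → ℝ)
    (A : Matrix (Fin m) (Fin m) ℝ)
    (hquad : ∀ p : Polynomial ℝ, p.natDegree ≤ 2 * m - 1 →
      ∑ i, b i * p.eval (c i) = ∫ x in (0:ℝ)..1, p.eval x)
    (hC : ∀ i : Fin m, ∀ q : ℕ, 1 ≤ q → q ≤ m →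
      ∑ j, A i j * c j ^ (q - 1) = c i ^ q / (q : ℝ)) :
    ∀ i j : Fin m,
      ((Matrix.of fun i j : Fin m => shiftedLegendre (j : ℕ) (c i))ᵀ *
          Matrix.diagonal b * A *
          (Matrix.of fun i j : Fin m => shiftedLegendre (j : ℕ) (c i))) i j =
        if (i : ℕ) = 0 ∧ (j : ℕ) = 0 then 1 / 2
        else if (i : ℕ) = (j : ℕ) + 1 then zetaIRK ((j : ℕ) + 1)
        else if (j : ℕ) = (i : ℕ) + 1 then -zetaIRK ((i : ℕ) + 1)
        else 0 := by
  intro i j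
  have hentry : ((Matrix.of fun i j : Fin m => shiftedLegendre (j : ℕ) (c i))ᵀ *
      Matrix.diagonal b * A * (Matrix.of fun i j : Fin m => shiftedLegendre (j : ℕ) (c i))) i j =
      √(2 * (i : ℕ) + 1) * √(2 * (j : ℕ) + 1) *
        ∫ x in (0 : ℝ)..1, (legendrePoly i).eval x * (legendrePrimitive j).eval x := by
    have hdeg : (legendrePoly i * legendrePrimitive j).natDegree ≤ 2 * m - 1 := by
      have h₁ := legendrePoly.natDegree_le i
      have h₂ := legendrePrimitive.natDegree_le j
      have h₃ := Polynomial.natDegree_mul_le (p := legendrePoly i) (q := legendrePrimitive j)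
      omega
    have hq := hquad _ hdeg
    simp only [Polynomial.eval_mul] at hq
    rw [← hq, Matrix.mul_assoc, Matrix.mul_apply, Finset.mul_sum]
    refine Finset.sum_congr rfl fun k _ => ?_
    rw [Matrix.mul_diagonal, Matrix.mul_apply]
    simp only [Matrix.transpose_apply, Matrix.of_apply]
    rw [sum_mul_shiftedLegendre_eq hC k j.isLt, legendrePoly.sqrt_mul_eval]
    ring
  rw [hentry]
  generalize (i : ℕ) = i
  generalize (j : ℕ) = j
  have hswap := legendrePrimitive.integral_mul_add_swap i j
  split_ifs with h₀ h₁ h₂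
  · obtain ⟨rfl, rfl⟩ := h₀
    simp only [and_self, if_true] at hswap
    simp only [Nat.cast_zero, mul_zero, zero_add, Real.sqrt_one, one_mul]
    linarith
  · subst h₁
    rw [legendrePrimitive.integral_mul_succ, sqrt_mul_sqrt_mul_eq_zetaIRK]
  · subst h₂
    rw [if_neg h₀, legendrePrimitive.integral_mul_succ] at hswap
    rw [eq_neg_of_add_eq_zero_left hswap, ← sqrt_mul_sqrt_mul_eq_zetaIRK]
    ring
  · rw [if_neg h₀] at hswap
    refine mul_eq_zero_of_right _ ?_
    rcases lt_trichotomy i j with h | rfl | h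
    · rw [legendrePrimitive.integral_mul_of_lt (show i + 1 < j by omega)] at hswap
      linarith
    · linarith
    · exact legendrePrimitive.integral_mul_of_lt (by omega)
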